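/- Let M be a [0,1]-module with a countable dual basis (e_i, φ_i)_{i∈I} such that e_i ≠ 0 and φ_i ≠ 0 for every i ∈ I. Then there exist a countable set J and an injective function Φ : M → (J → [0,∞)) such that: (i) Φ(r·x) = r·Φ(x) pointwise for all r ∈ [0,1] and x ∈ M; (ii) for every countable family (x_i) in M, the sum Σ_i x_i is defined in M iff for every j ∈ J the series ∑_i Φ(x_i)(j) converges and the function j ↦ ∑_i Φ(x_i)(j) lies in the image of Φ, in which case Φ(Σ_i x_i)(j) = ∑_i Φ(x_i)(j) for every j ∈ J; (iii) the image of Φ is downward closed: if u : J → [0,∞) satisfies u(j) ≤ Φ(x)(j) for all j ∈ J and some x ∈ M, then u lies in the image of Φ; (iv) for every j ∈ J the set { Φ(x)(j) : x ∈ M } is bounded above. -/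

import Mathlib

/-- A Σ-monoid: a set with a partial countable sum, represented via `Option`. -/
structure SigmaMonoid (M : Type) where
  zero : M
  sum : (ℕ → M) → Option M
  sum_unit : ∀ (x : ℕ → M) (j : ℕ), (∀ i, i ≠ j → x i = zero) → sum x = some (x j)
  sum_perm : ∀ (I J : Set ℕ) (σ : ↥(Iᶜ) ≃ ↥(Jᶜ)) (x y : ℕ → M),
      (∀ i ∈ I, x i = zero) → (∀ j ∈ J, y j = zero) →
      (∀ i : ↥(Iᶜ), x i.1 = y (σ i).1) → sum x = sum y
  sum_assoc : ∀ (σ : ℕ × ℕ ≃ ℕ) (x s : ℕ → M),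
      (∀ j, sum (fun k => x (σ (j, k))) = some (s j)) → sum x = sum s
  sum_assoc_inner : ∀ (σ : ℕ × ℕ ≃ ℕ) (x : ℕ → M) (v : M),
      sum x = some v → ∀ j, ∃ w, sum (fun k => x (σ (j, k))) = some w

/-- The (partial) binary sum `x + y`, i.e. the sum of the family `(x, y, 0, 0, …)`. -/
def SigmaMonoid.add {M : Type} (S : SigmaMonoid M) (x y : M) : Option M :=
  S.sum (fun n => if n = 0 then x else if n = 1 then y else S.zero)

/-- A Σ-monoid homomorphism. -/
def SigmaHom {M N : Type} (S : SigmaMonoid M) (T : SigmaMonoid N) (f : M → N) : Prop :=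
  f S.zero = T.zero ∧
  ∀ (x : ℕ → M) (v : M), S.sum x = some v → T.sum (fun i => f (x i)) = some (f v)

/-- A Σ-semiring: a Σ-monoid with a total commutative multiplication distributing
over the partial sums. -/
structure SigmaSemiring (R : Type) extends SigmaMonoid R where
  one : R
  mul : R → R → R
  mul_assoc' : ∀ a b c, mul (mul a b) c = mul a (mul b c)
  mul_comm' : ∀ a b, mul a b = mul b a
  one_mul' : ∀ a, mul one a = a
  zero_mul' : ∀ a, mul zero a = zero
  mul_sum : ∀ (e : ℕ ≃ ℕ × ℕ) (r s : ℕ → R) (a b : R),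
      sum r = some a → sum s = some b →
      sum (fun n => mul (r (e n).1) (s (e n).2)) = some (mul a b)

/-- A module over a Σ-semiring. -/
structure SigmaModule (R : Type) (S : SigmaSemiring R) (M : Type) extends SigmaMonoid M where
  smul : R → M → M
  one_smul' : ∀ x, smul S.one x = x
  mul_smul' : ∀ r s x, smul (S.mul r s) x = smul r (smul s x)
  zero_smul' : ∀ x, smul S.zero x = zero
  smul_zero' : ∀ r, smul r zero = zero
  smul_sum : ∀ (e : ℕ ≃ ℕ × ℕ) (r : ℕ → R) (x : ℕ → M) (a : R) (b : M),
      S.sum r = some a → sum x = some b →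
      sum (fun n => smul (r (e n).1) (x (e n).2)) = some (smul a b)

/-- An `R`-linear map between `R`-modules. -/
def RLinear {R M N : Type} (S : SigmaSemiring R)
    (MM : SigmaModule R S M) (NN : SigmaModule R S N) (f : M → N) : Prop :=
  f MM.zero = NN.zero ∧
  (∀ (x : ℕ → M) (v : M), MM.sum x = some v → NN.sum (fun i => f (x i)) = some (f v)) ∧
  (∀ r x, f (MM.smul r x) = NN.smul r (f x))

/-- The unit interval `[0,1]`, as a subtype of the nonnegative reals. -/
def UnitI : Type := {r : NNReal // r ≤ 1}

def uZero : UnitI := ⟨0, zero_le_one⟩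

def uOne : UnitI := ⟨1, le_refl 1⟩

def uMul (a b : UnitI) : UnitI :=
  ⟨a.1 * b.1, by
    calc a.1 * b.1 ≤ 1 * 1 := mul_le_mul' a.2 b.2
    _ = 1 := one_mul 1⟩

open Classical in
/-- The partial sum on `[0,1]`: `Σ_i r_i` is defined iff the series converges
to a value `≤ 1`, in which case that value is the sum. -/
noncomputable def uSum (r : ℕ → UnitI) : Option UnitI :=
  if h : (∑' i, ((r i).1 : ENNReal)) ≤ 1 then
    some ⟨(∑' i, ((r i).1 : ENNReal)).toNNReal, by
      have hne : (∑' i, ((r i).1 : ENNReal)) ≠ ⊤ :=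
        ne_top_of_le_ne_top ENNReal.one_ne_top h
      exact ENNReal.coe_le_coe.mp
        (by rw [ENNReal.coe_toNNReal hne]; exact_mod_cast h)⟩
  else none

open Classical in
/-- `sumIdx S f v` says that the sum of the countable family `f`, taken along
an enumeration of its index set padded with zeros (which is independent of the
enumeration by the permutation axiom), is defined and equals `v`. -/
def sumIdx {M : Type} (S : SigmaMonoid M) {ι : Type} (f : ι → M) (v : M) : Prop :=
  ∃ e : ι ↪ ℕ,
    S.sum (fun n => if h : ∃ i, e i = n then f h.choose else S.zero) = some v

/-- A `[0,1]`-linear map from a `[0,1]`-module to `[0,1]` itself. -/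
def UnitLinearMap (U : SigmaSemiring UnitI) {M : Type}
    (MM : SigmaModule UnitI U M) (φ : M → UnitI) : Prop :=
  φ MM.zero = U.zero ∧
  (∀ (x : ℕ → M) (v : M), MM.sum x = some v →
    U.sum (fun i => φ (x i)) = some (φ v)) ∧
  (∀ (r : UnitI) (x : M), φ (MM.smul r x) = U.mul r (φ x))

/-- A countable dual basis `(e_i, φ_i)_{i ∈ ι}` of a `[0,1]`-module:
each `φ_i` is `[0,1]`-linear and `x = Σ_{i∈ι} φ_i(x)·e_i` for every `x`. -/
def IsDualBasis (U : SigmaSemiring UnitI) {M ι : Type}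
    (MM : SigmaModule UnitI U M) (e : ι → M) (φ : ι → M → UnitI) : Prop :=
  (∀ i, UnitLinearMap U MM (φ i)) ∧
  ∀ x : M, sumIdx MM.toSigmaMonoid (fun i => MM.smul (φ i x) (e i)) x

theorem uSum_iff (r : ℕ → UnitI) (a : UnitI) :
    uSum r = some a ↔ ∑' i, ((r i).1 : ENNReal) = (a.1 : ENNReal) := by
  unfold uSum
  constructor
  · intro h
    split_ifs at h with h1
    have h2 := Option.some.inj h
    rw [← h2]
    exact (ENNReal.coe_toNNReal (ne_top_of_le_ne_top ENNReal.one_ne_top h1)).symm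
  · intro h
    have h1 : (∑' i, ((r i).1 : ENNReal)) ≤ 1 := by
      rw [h]; exact_mod_cast a.2
    rw [dif_pos h1]
    congr 1
    apply Subtype.ext
    simp only [h, ENNReal.toNNReal_coe]

theorem core_real (p : ℕ → ℕ → ℝ) (hp : ∀ i j, 0 ≤ p i j)
    (hpp : ∀ i j, HasSum (fun l => p i l * p l j) (p i j))
    (h : ℕ → ℝ) (hh : ∀ i, 0 ≤ h i) (hph : ∀ i, HasSum (fun l => p i l * h l) (h i))
    (k : ℕ) (hk : ∃ i, 0 < p i k) :
    ∃ c : ℝ, h k = c * p k k ∧ ∀ l, 0 < p k l → h l = c * p l k := by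
  obtain ⟨i0, hi0⟩ := hk
  set A : Set ℝ := {c | ∀ i, c * p i k ≤ h i} with hA
  have hA0 : (0 : ℝ) ∈ A := by intro i; simpa using hh i
  have hAb : BddAbove A := ⟨h i0 / p i0 k, fun c hc => by
    rw [le_div_iff₀ hi0]; exact hc i0⟩
  have hAc : IsClosed A := by
    have : A = ⋂ i, {c | c * p i k ≤ h i} := by ext c; simp [hA]
    rw [this]
    exact isClosed_iInter fun i => isClosed_le (by fun_prop) (by fun_prop)
  set c := sSup A with hc
  have hcA : c ∈ A := hAc.csSup_mem ⟨0, hA0⟩ hAb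
  set g : ℕ → ℝ := fun i => h i - c * p i k with hg
  have hg0 : ∀ i, 0 ≤ g i := fun i => sub_nonneg.2 (hcA i)
  have hpg : ∀ i, HasSum (fun l => p i l * g l) (g i) := by
    intro i
    have := (hph i).sub ((hpp i k).mul_left c)
    have h2 : (fun l => p i l * g l) = fun l => p i l * h l - c * (p i l * p l k) := by
      funext l
      show p i l * (h l - c * p l k) = _
      ring
    rw [h2]
    exact this
  have hle : ∀ i l, p i l * g l ≤ g i := fun i l =>
    le_hasSum (hpg i) l (fun j _ => mul_nonneg (hp i j) (hg0 j))
  have hgk : g k = 0 := by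
    have : c + g k ∈ A := by
      intro i
      have := hle i k
      simp only [hg] at this ⊢
      nlinarith
    have h2 := le_csSup hAb this
    have := hg0 k
    linarith
  refine ⟨c, by simp only [hg] at hgk; linarith, fun l hl => ?_⟩
  have h1 := hle k l
  rw [hgk] at h1
  have h2 : g l = 0 := by
    have := hg0 l
    by_contra hne
    have h3 : 0 < g l := lt_of_le_of_ne this (Ne.symm hne)
    have := mul_pos hl h3
    linarith
  simp only [hg] at h2; linarith

theorem fubini {M : Type} (S : SigmaMonoid M) (z : ℕ → ℕ → M) (s t : ℕ → M)
    (hs : ∀ k, S.sum (z k) = some (s k)) (ht : ∀ i, S.sum (fun k => z k i) = some (t i)) :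
    S.sum s = S.sum t := by
  let τ : ℕ × ℕ ≃ ℕ := Nat.pairEquiv
  let x : ℕ → M := fun n => z (τ.symm n).1 (τ.symm n).2
  have h1 := S.sum_assoc τ x s (fun j => by simpa [x] using hs j)
  have h2 := S.sum_assoc ((Equiv.prodComm ℕ ℕ).trans τ) x t (fun j => by simpa [x] using ht j)
  rw [← h1, h2]

theorem fubini_ex {M : Type} (S : SigmaMonoid M) (z : ℕ → ℕ → M) (s : ℕ → M) (v : M)
    (hs : ∀ k, S.sum (z k) = some (s k)) (hv : S.sum s = some v) (i : ℕ) :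
    ∃ w, S.sum (fun k => z k i) = some w := by
  let τ : ℕ × ℕ ≃ ℕ := Nat.pairEquiv
  let x : ℕ → M := fun n => z (τ.symm n).1 (τ.symm n).2
  have h1 := S.sum_assoc τ x s (fun j => by simpa [x] using hs j)
  have h2 := S.sum_assoc_inner ((Equiv.prodComm ℕ ℕ).trans τ) x v (h1.trans hv) i
  simpa [x] using h2

theorem sum_reindex {M ι : Type} (S : SigmaMonoid M) (f : ι → M) (ε ε' : ι ↪ ℕ) (x y : ℕ → M)
    (hx : ∀ i, x (ε i) = f i) (hx0 : ∀ n, (¬ ∃ i, ε i = n) → x n = S.zero)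
    (hy : ∀ i, y (ε' i) = f i) (hy0 : ∀ n, (¬ ∃ i, ε' i = n) → y n = S.zero) :
    S.sum x = S.sum y := by
  let σ : ↥(((Set.range ε)ᶜ)ᶜ) ≃ ↥(((Set.range ε')ᶜ)ᶜ) :=
    (Equiv.setCongr (compl_compl _)).trans ((Equiv.ofInjective ε ε.injective).symm.trans
      ((Equiv.ofInjective ε' ε'.injective).trans (Equiv.setCongr (compl_compl _)).symm))
  refine S.sum_perm _ _ σ x y (fun n hn => hx0 n (by simpa using hn))
    (fun n hn => hy0 n (by simpa using hn)) ?_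
  rintro ⟨n, hn⟩
  have hn' : n ∈ Set.range ε := by simpa using hn
  obtain ⟨i, rfl⟩ := hn'
  have : (σ ⟨ε i, hn⟩).1 = ε' i := by
    have h1 : (Equiv.ofInjective ε ε.injective).symm ⟨ε i, ⟨i, rfl⟩⟩ = i :=
      Equiv.ofInjective_symm_apply ε.injective i
    simp only [σ, Equiv.trans_apply, Equiv.setCongr_apply, Equiv.setCongr_symm_apply,
      Equiv.ofInjective_apply, h1]
  rw [this, hx, hy]

theorem sum_smul_right {R M : Type} {U : SigmaSemiring R} (MM : SigmaModule R U M)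
    (r : ℕ → R) (a : R) (x : M) (h : U.sum r = some a) :
    MM.sum (fun i => MM.smul (r i) x) = some (MM.smul a x) := by
  let w : ℕ → M := fun n => if n = 0 then x else MM.zero
  have hw : MM.sum w = some x := by
    have := MM.sum_unit w 0 (fun i hi => by simp [w, hi])
    simpa [w] using this
  let τ : ℕ × ℕ ≃ ℕ := Nat.pairEquiv
  have h1 := MM.smul_sum τ.symm r w a x h hw
  rw [← h1]
  symm
  apply MM.sum_assoc τ
  intro j
  have := MM.sum_unit (fun k => MM.smul (r j) (w k)) 0
    (fun i hi => by simp [w, hi, MM.smul_zero'])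
  simpa [w] using this

theorem sub_sum (U : SigmaSemiring UnitI) (hUzero : U.zero = uZero) (hUone : U.one = uOne)
    (hUsum : U.sum = uSum) {M : Type}
    (MM : SigmaModule UnitI U M) (x : ℕ → M) (v : M) (hv : MM.sum x = some v) (r : ℕ → UnitI) :
    ∃ w, MM.sum (fun i => MM.smul (r i) (x i)) = some w := by
  let q : ℕ → ℕ → UnitI := fun i j =>
    if j = 0 then r i else if j = 1 then ⟨1 - (r i).1, tsub_le_self⟩ else uZero
  have hq : ∀ i, U.sum (q i) = some U.one := by
    intro i
    rw [hUsum, hUone, uSum_iff]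
    rw [tsum_eq_sum (s := Finset.range 2)]
    · simp only [Finset.sum_range_succ, Finset.sum_range_zero, q]
      have := (r i).2
      simp only [uOne]
      norm_num
      exact_mod_cast add_tsub_cancel_of_le this
    · intro j hj
      have h0 : j ≠ 0 := by rintro rfl; simp at hj
      have h1 : j ≠ 1 := by rintro rfl; simp at hj
      simp [q, h0, h1, uZero]
  have := fubini_ex MM.toSigmaMonoid (fun i j => MM.smul (q i j) (x i)) x v
    (fun k => by
      have := sum_smul_right MM (q k) _ (x k) (hq k)
      rwa [MM.one_smul'] at this) hv 0
  simpa [q] using this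

theorem nat_case (U : SigmaSemiring UnitI)
    (hUzero : U.zero = uZero) (hUone : U.one = uOne)
    (hUsum : U.sum = uSum) (hUmul : U.mul = uMul)
    {M : Type} (MM : SigmaModule UnitI U M)
    (e : ℕ → M) (φ : ℕ → M → UnitI)
    (hlin : ∀ i, UnitLinearMap U MM (φ i))
    (hb : ∀ x, MM.sum (fun n => MM.smul (φ n x) (e n)) = some x)
    (hgood : ∀ n, ((∀ x, φ n x = uZero) ∧ e n = MM.zero) ∨
      (e n ≠ MM.zero ∧ ∃ x, φ n x ≠ uZero)) :
    ∃ (J : Type) (Φ : M → J → NNReal),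
      Countable J ∧
      Function.Injective Φ ∧
      (∀ (r : UnitI) (x : M), Φ (MM.smul r x) = fun j => r.1 * Φ x j) ∧
      (∀ x : ℕ → M,
        ((∃ v, MM.sum x = some v) ↔
          ((∀ j, (∑' i, ((Φ (x i) j : ENNReal))) ≠ ⊤) ∧
            ∃ y : M, ∀ j, (Φ y j : ENNReal) = ∑' i, (Φ (x i) j : ENNReal))) ∧
        (∀ v, MM.sum x = some v →
          ∀ j, (Φ v j : ENNReal) = ∑' i, (Φ (x i) j : ENNReal))) ∧
      (∀ (u : J → NNReal) (x : M), (∀ j, u j ≤ Φ x j) → ∃ y, Φ y = u) ∧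
      (∀ j, ∃ C : NNReal, ∀ x : M, Φ x j ≤ C) := by
  classical
  let f : ℕ → M → NNReal := fun k x => (φ k x).1
  have fsmul : ∀ k r x, f k (MM.smul r x) = r.1 * f k x := by
    intro k r x
    simp only [f]
    rw [(hlin k).2.2, hUmul]; rfl
  have fsum : ∀ k x v, MM.sum x = some v → ∑' i, (f k (x i) : ENNReal) = f k v := by
    intro k x v h
    have := (hlin k).2.1 x v h
    rw [hUsum, uSum_iff] at this
    exact this
  let p : ℕ → ℕ → NNReal := fun i j => f i (e j)
  have harm : ∀ i x, HasSum (fun l => p i l * f l x) (f i x) := by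
    intro i x
    have h1 := fsum i _ x (hb x)
    simp only [fsmul] at h1
    have h2 : HasSum (fun l => ((p i l * f l x : NNReal) : ENNReal)) (f i x : ENNReal) := by
      rw [← h1]
      convert ENNReal.summable.hasSum using 3 with l
      simp only [p, f]; rw [mul_comm]
    exact ENNReal.hasSum_coe.1 h2
  have inj : ∀ x y, (∀ k, f k x = f k y) → x = y := by
    intro x y h
    have h1 := hb x
    have h2 : (fun n => MM.smul (φ n x) (e n)) = (fun n => MM.smul (φ n y) (e n)) := by
      funext n
      rw [show φ n x = φ n y from Subtype.ext (h n)]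
    rw [h2, hb y] at h1
    exact (Option.some.inj h1).symm
  have f0 : ∀ k, f k MM.zero = 0 := by
    intro k
    simp only [f]; rw [(hlin k).1, hUzero]; rfl
  have core : ∀ k, (∃ i, 0 < p i k) → ∀ x, ∃ c : ℝ, (f k x : ℝ) = c * p k k ∧
      ∀ l, 0 < p k l → (f l x : ℝ) = c * p l k := by
    intro k hk x
    obtain ⟨i, hi⟩ := hk
    obtain ⟨c, hc1, hc2⟩ := core_real (fun i j => (p i j : ℝ)) (fun i j => (p i j).2)
      (fun i j => by exact_mod_cast NNReal.hasSum_coe.2 (harm i (e j)))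
      (fun i => (f i x : ℝ)) (fun i => (f i x).2)
      (fun i => by exact_mod_cast NNReal.hasSum_coe.2 (harm i x)) k ⟨i, by exact_mod_cast hi⟩
    exact ⟨c, hc1, fun l hl => hc2 l (by exact_mod_cast hl)⟩
  -- nondegenerate columns
  have diag : ∀ k x, f k x ≠ 0 → 0 < p k k := by
    intro k x hx
    have hne : e k ≠ MM.zero := by
      rcases hgood k with h | h
      · exact absurd (by simp only [f]; rw [h.1 x]; rfl) hx
      · exact h.1
    have hk : ∃ i, 0 < p i k := by
      by_contra hcon
      push Not at hcon
      exact hne (inj _ _ fun i => by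
        rw [f0]; exact le_antisymm (hcon i) (zero_le))
    obtain ⟨c, hc, _⟩ := core k hk x
    rw [pos_iff_ne_zero]
    intro h0
    rw [h0] at hc
    apply hx
    simpa using hc
  have prop : ∀ k l, 0 < p k l → ∀ x, f l x = p l k / p k k * f k x := by
    intro k l hl x
    have hkk := diag k (e l) hl.ne'
    obtain ⟨c, h1, h2⟩ := core k ⟨k, hkk⟩ x
    have h3 := h2 l hl
    have hkk' : (p k k : ℝ) ≠ 0 := by exact_mod_cast hkk.ne'
    apply NNReal.eq
    push_cast
    rw [h3, h1]; field_simp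
  have colpos : ∀ k l, 0 < p k l → 0 < p l l := by
    intro k l hl
    have h1 : e l ≠ MM.zero := by
      intro h; simp only [p, h, f0] at hl; exact lt_irrefl _ hl
    rcases hgood l with h | ⟨_, x, hx⟩
    · exact absurd h.2 h1
    · refine diag l x fun h0 => hx (Subtype.ext h0)
  have symm : ∀ k l, 0 < p k l → 0 < p l k := by
    intro k l hl
    have h1 := prop k l hl (e l)
    have h2 := colpos k l hl
    rw [pos_iff_ne_zero]
    intro h0
    have h3 : p l l = p l k / p k k * p k l := h1
    rw [h0] at h3
    simp only [zero_div, zero_mul] at h3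
    exact h2.ne' h3
  have trans : ∀ k l m, 0 < p k l → 0 < p l m → 0 < p k m := by
    intro k l m h1 h2
    have h3 : p k l * p l m ≤ p k m := le_hasSum (harm k (e m)) l (fun j _ => zero_le)
    exact lt_of_lt_of_le (mul_pos h1 h2) h3
  let J : Type := {c : ℕ // 0 < p c c ∧ ∀ l, 0 < p c l → c ≤ l}
  have rep : ∀ k, 0 < p k k → ∃ j : J, 0 < p j.1 k := by
    intro k hk
    have hex : ∃ c, 0 < p k c := ⟨k, hk⟩
    have hc := Nat.find_spec hex
    refine ⟨⟨Nat.find hex, colpos _ _ hc, fun l hl => ?_⟩, symm _ _ hc⟩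
    exact Nat.find_min' hex (trans _ _ _ hc hl)
  have uniq : ∀ (j c : J) k, 0 < p j.1 k → 0 < p c.1 k → j = c := by
    intro j c k h1 h2
    have h3 := trans _ _ _ h1 (symm _ _ h2)
    exact Subtype.ext (le_antisymm (j.2.2 _ h3) (c.2.2 _ (symm _ _ h3)))
  have dich : ∀ k, (∀ x, f k x = 0) ∨ ∃ j : J, ∃ a : NNReal, ∀ x, f k x = a * f j.1 x := by
    intro k
    by_cases hk : 0 < p k k
    · obtain ⟨j, hj⟩ := rep k hk
      exact Or.inr ⟨j, _, prop _ _ hj⟩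
    · left
      intro x
      by_contra hx
      exact hk (diag k x hx)
  refine ⟨J, fun x j => f j.1 x, inferInstanceAs (Countable {c : ℕ // _}), ?_, ?_, ?_, ?_, ?_⟩
  · intro x y hxy
    refine inj x y fun k => ?_
    rcases dich k with h | ⟨j, a, h⟩
    · rw [h, h]
    · rw [h, h, show f j.1 x = f j.1 y from congrFun hxy j]
  · intro r x
    funext j
    exact fsmul _ _ _
  · intro x
    have key : ∀ v, MM.sum x = some v → ∀ j : J,
        (f j.1 v : ENNReal) = ∑' i, (f j.1 (x i) : ENNReal) :=
      fun v hv j => (fsum _ _ _ hv).symm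
    refine ⟨⟨?_, ?_⟩, key⟩
    · rintro ⟨v, hv⟩
      refine ⟨fun j => ?_, v, key v hv⟩
      rw [← key v hv j]
      exact ENNReal.coe_ne_top
    · rintro ⟨_, y, hy⟩
      have hall : ∀ k, ∑' i, (f k (x i) : ENNReal) = f k y := by
        intro k
        rcases dich k with h | ⟨j, a, h⟩
        · simp [h]
        · simp only [h, ENNReal.coe_mul]
          rw [ENNReal.tsum_mul_left]
          congr 1
          exact (hy j).symm
      refine ⟨y, ?_⟩
      have := fubini MM.toSigmaMonoid (fun k i => MM.smul (φ k (x i)) (e k))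
        (fun k => MM.smul (φ k y) (e k)) x
        (fun k => sum_smul_right MM (fun i => φ k (x i)) (φ k y) (e k)
          (by rw [hUsum, uSum_iff]; exact hall k))
        (fun i => hb (x i))
      rw [← this]
      exact hb y
  · intro u x hu
    have hr : ∀ k, ∃ r : UnitI, ∀ j : J, 0 < p j.1 k → r.1 = u j / f j.1 x := by
      intro k
      by_cases hk : ∃ j : J, 0 < p j.1 k
      · obtain ⟨j, hj⟩ := hk
        refine ⟨⟨u j / f j.1 x, div_le_one_of_le₀ (hu j) zero_le⟩, fun c hc => ?_⟩
        rw [uniq j c k hj hc]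
      · exact ⟨uZero, fun j hj => absurd ⟨j, hj⟩ hk⟩
    choose r hr using hr
    obtain ⟨y, hy⟩ := sub_sum U hUzero hUone hUsum MM _ x (hb x) r
    refine ⟨y, ?_⟩
    funext c
    have h1 := fsum c.1 _ _ hy
    have h2 : ∀ k, f c.1 (MM.smul (r k) (MM.smul (φ k x) (e k)))
        = u c / f c.1 x * (p c.1 k * f k x) := by
      intro k
      rw [fsmul, fsmul]
      by_cases hk : 0 < p c.1 k
      · rw [hr k c hk]
        simp only [p, f]; ring
      · have h0 : p c.1 k = 0 := le_antisymm (not_lt.1 hk) zero_le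
        have h0' : f c.1 (e k) = 0 := h0
        rw [h0, h0']; simp
    simp only [h2] at h1
    have h3 := ENNReal.hasSum_coe.2 ((harm c.1 x).mul_left (u c / f c.1 x))
    rw [h3.tsum_eq] at h1
    have h4 : u c / f c.1 x * f c.1 x = f c.1 y := by exact_mod_cast h1
    show f c.1 y = u c
    rw [← h4]
    by_cases hx : f c.1 x = 0
    · have h5 : u c ≤ f c.1 x := hu c
      rw [hx] at h5 ⊢
      simp only [mul_zero]
      exact (le_antisymm h5 zero_le).symm
    · exact div_mul_cancel₀ _ hx
  · intro j
    exact ⟨1, fun x => (φ j.1 x).2⟩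

/-- A `[0,1]`-module with a countable dual basis (with nonzero basis vectors
and nonzero coordinate functionals) embeds, via an injective map `Φ`, as a
downward-closed full subalgebra of a product `J → [0,∞)` over a countable
index set `J`, with bounded coordinates. -/
theorem stmt18 (U : SigmaSemiring UnitI)
    (hUzero : U.zero = uZero) (hUone : U.one = uOne)
    (hUsum : U.sum = uSum) (hUmul : U.mul = uMul)
    {M ι : Type} [Countable ι]
    (MM : SigmaModule UnitI U M)
    (e : ι → M) (φ : ι → M → UnitI)
    (hbasis : IsDualBasis U MM e φ)
    (he0 : ∀ i, e i ≠ MM.zero)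
    (hφ0 : ∀ i, φ i ≠ fun _ => U.zero) :
    ∃ (J : Type) (Φ : M → J → NNReal),
      Countable J ∧
      Function.Injective Φ ∧
      (∀ (r : UnitI) (x : M), Φ (MM.smul r x) = fun j => r.1 * Φ x j) ∧
      (∀ x : ℕ → M,
        ((∃ v, MM.sum x = some v) ↔
          ((∀ j, (∑' i, ((Φ (x i) j : ENNReal))) ≠ ⊤) ∧
            ∃ y : M, ∀ j, (Φ y j : ENNReal) = ∑' i, (Φ (x i) j : ENNReal))) ∧
        (∀ v, MM.sum x = some v →
          ∀ j, (Φ v j : ENNReal) = ∑' i, (Φ (x i) j : ENNReal))) ∧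
      (∀ (u : J → NNReal) (x : M), (∀ j, u j ≤ Φ x j) → ∃ y, Φ y = u) ∧
      (∀ j, ∃ C : NNReal, ∀ x : M, Φ x j ≤ C) := by
  classical
  obtain ⟨ε, hε⟩ := exists_injective_nat ι
  let E : ℕ → M := Function.extend ε e (fun _ => MM.zero)
  let F : ℕ → M → UnitI := Function.extend ε φ (fun _ _ => uZero)
  have hE : ∀ i, E (ε i) = e i := fun i => hε.extend_apply _ _ i
  have hF : ∀ i, F (ε i) = φ i := fun i => hε.extend_apply _ _ i
  have hE0 : ∀ n, (¬ ∃ i, ε i = n) → E n = MM.zero :=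
    fun n hn => Function.extend_apply' _ _ _ hn
  have hF0 : ∀ n, (¬ ∃ i, ε i = n) → F n = fun _ => uZero :=
    fun n hn => Function.extend_apply' _ _ _ hn
  refine nat_case U hUzero hUone hUsum hUmul MM E F ?_ ?_ ?_
  · intro n
    by_cases hn : ∃ i, ε i = n
    · obtain ⟨i, rfl⟩ := hn
      rw [hF]; exact hbasis.1 i
    · rw [hF0 n hn]
      refine ⟨hUzero.symm, fun x v _ => ?_, fun r x => ?_⟩
      · rw [hUsum, uSum_iff]; simp [uZero]
      · rw [U.mul_comm', ← hUzero, U.zero_mul']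
  · intro x
    obtain ⟨ε', h'⟩ := hbasis.2 x
    rw [← h']
    refine sum_reindex MM.toSigmaMonoid (fun i => MM.smul (φ i x) (e i)) ⟨ε, hε⟩ ε' _ _ ?_ ?_ ?_ ?_
    · intro i
      simp only [Function.Embedding.coeFn_mk, hE, hF]
    · intro n hn
      simp only [hE0 n hn, MM.smul_zero']
    · intro i
      have hex : ∃ a, ε' a = ε' i := ⟨i, rfl⟩
      have hch : hex.choose = i := ε'.injective hex.choose_spec
      simp only [dif_pos hex, hch]
    · intro n hn
      simp only [dif_neg hn]
  · intro n
    by_cases hn : ∃ i, ε i = n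
    · obtain ⟨i, rfl⟩ := hn
      right
      rw [hE, hF]
      refine ⟨he0 i, ?_⟩
      by_contra hcon
      push Not at hcon
      exact hφ0 i (funext fun x => by rw [hcon x, hUzero])
    · left
      exact ⟨fun x => by rw [hF0 n hn], hE0 n hn⟩
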